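/- For every prime p ≥ 5, no extraspecial p-group of order p^5 has an automorphism of order p^2. -/

import Mathlib

/-- A finite group `G` is an extraspecial `p`-group if its center, derived subgroup
and Frattini subgroup all coincide and have order `p`. -/
def IsExtraspecial (p : ℕ) (G : Type*) [Group G] : Prop :=
  IsPGroup p G ∧ Subgroup.center G = commutator G ∧
    commutator G = frattini G ∧ Nat.card (Subgroup.center G) = p

open scoped commutatorElement

section CentralCommutators

variable {G : Type*} [Group G]

theorem commutatorElement_mul_left_of_central (hc : ∀ x y : G, ⁅x, y⁆ ∈ Subgroup.center G)
    (x y z : G) : ⁅x * y, z⁆ = ⁅x, z⁆ * ⁅y, z⁆ := by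
  have h := Subgroup.mem_center_iff.1 (hc y z)
  have e : ⁅x * y, z⁆ = x * ⁅y, z⁆ * x⁻¹ * ⁅x, z⁆ := by
    simp only [commutatorElement_def]; group
  rw [e, h x, mul_inv_cancel_right, ← h]

theorem commutatorElement_mul_right_of_central (hc : ∀ x y : G, ⁅x, y⁆ ∈ Subgroup.center G)
    (x y z : G) : ⁅x, y * z⁆ = ⁅x, y⁆ * ⁅x, z⁆ := by
  rw [← commutatorElement_inv, commutatorElement_mul_left_of_central hc, mul_inv_rev,
    commutatorElement_inv, commutatorElement_inv]
  exact Subgroup.mem_center_iff.1 (hc x y) _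

theorem commutatorElement_eq_one_of_mem_center_left {z : G} (hz : z ∈ Subgroup.center G) (x : G) :
    ⁅z, x⁆ = 1 :=
  commutatorElement_eq_one_iff_mul_comm.2 (Subgroup.mem_center_iff.1 hz x).symm

theorem commutatorElement_eq_one_of_mem_center_right {z : G} (hz : z ∈ Subgroup.center G) (x : G) :
    ⁅x, z⁆ = 1 :=
  commutatorElement_eq_one_iff_mul_comm.2 (Subgroup.mem_center_iff.1 hz x)

theorem commutatorElement_pow_left_of_central (hc : ∀ x y : G, ⁅x, y⁆ ∈ Subgroup.center G)
    (x y : G) (n : ℕ) : ⁅x ^ n, y⁆ = ⁅x, y⁆ ^ n := by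
  induction n with
  | zero => simp
  | succ n ih => rw [pow_succ, commutatorElement_mul_left_of_central hc, ih, pow_succ]

theorem pow_mem_center_of_commutatorElement_pow_eq_one {n : ℕ}
    (hc : ∀ x y : G, ⁅x, y⁆ ∈ Subgroup.center G) (hpow : ∀ x y : G, ⁅x, y⁆ ^ n = 1) (x : G) :
    x ^ n ∈ Subgroup.center G :=
  Subgroup.mem_center_iff.2 fun y => (commutatorElement_eq_one_iff_mul_comm.1
    ((commutatorElement_pow_left_of_central hc x y n).trans (hpow x y))).symm

/-- The Baer sum on a group whose commutators are central and of odd order dividing `2 * h - 1`,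
so that `h` plays the role of one half. -/
@[reducible]
def baerAddCommGroup (h : ℕ) (hc : ∀ x y : G, ⁅x, y⁆ ∈ Subgroup.center G)
    (hpow : ∀ x y : G, ⁅x, y⁆ ^ (2 * h) = ⁅x, y⁆) : AddCommGroup G where
  add x y := x * y * ⁅y, x⁆ ^ h
  zero := 1
  neg x := x⁻¹
  nsmul := @nsmulRec G ⟨1⟩ ⟨fun x y => x * y * ⁅y, x⁆ ^ h⟩
  zsmul := @zsmulRec G ⟨1⟩ ⟨fun x y => x * y * ⁅y, x⁆ ^ h⟩ ⟨fun x => x⁻¹⟩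
    (@nsmulRec G ⟨1⟩ ⟨fun x y => x * y * ⁅y, x⁆ ^ h⟩)
  add_assoc x y z := by
    change x * y * ⁅y, x⁆ ^ h * z * ⁅z, x * y * ⁅y, x⁆ ^ h⁆ ^ h
      = x * (y * z * ⁅z, y⁆ ^ h) * ⁅y * z * ⁅z, y⁆ ^ h, x⁆ ^ h
    have hm : ∀ a b : G, ⁅a, b⁆ ^ h ∈ Subgroup.center G := fun a b => pow_mem (hc a b) h
    have cm : ∀ a b g : G, g * ⁅a, b⁆ ^ h = ⁅a, b⁆ ^ h * g := fun a b =>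
      Subgroup.mem_center_iff.1 (hm a b)
    rw [commutatorElement_mul_right_of_central hc, commutatorElement_mul_right_of_central hc,
      commutatorElement_mul_left_of_central hc, commutatorElement_mul_left_of_central hc,
      commutatorElement_eq_one_of_mem_center_left (hm z y),
      commutatorElement_eq_one_of_mem_center_right (hm y x), mul_one, mul_one,
      Commute.mul_pow (Subgroup.mem_center_iff.1 (hc z y) _),
      Commute.mul_pow (Subgroup.mem_center_iff.1 (hc z x) _)]
    calc x * y * ⁅y, x⁆ ^ h * z * (⁅z, x⁆ ^ h * ⁅z, y⁆ ^ h)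
        = x * y * (⁅y, x⁆ ^ h * z) * (⁅z, x⁆ ^ h * ⁅z, y⁆ ^ h) := by group
      _ = x * y * z * (⁅y, x⁆ ^ h * ⁅z, x⁆ ^ h * ⁅z, y⁆ ^ h) := by rw [← cm y x z]; group
      _ = x * (y * z * ⁅z, y⁆ ^ h) * (⁅y, x⁆ ^ h * ⁅z, x⁆ ^ h) := by rw [cm z y]; group
  zero_add x := by
    change 1 * x * ⁅x, 1⁆ ^ h = x
    simp
  add_zero x := by
    change x * 1 * ⁅1, x⁆ ^ h = x
    simp
  neg_add_cancel x := by
    change x⁻¹ * x * ⁅x, x⁻¹⁆ ^ h = 1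
    simp [commutatorElement_def]
  add_comm x y := by
    change x * y * ⁅y, x⁆ ^ h = y * x * ⁅x, y⁆ ^ h
    have e : x * y * ⁅y, x⁆ = y * x := by
      rw [Subgroup.mem_center_iff.1 (hc y x), commutatorElement_def]; group
    have hinv : ⁅y, x⁆ ^ h * ⁅x, y⁆ ^ h = 1 := by
      rw [← commutatorElement_inv y x, inv_pow, mul_inv_cancel]
    calc x * y * ⁅y, x⁆ ^ h
        = x * y * ⁅y, x⁆ ^ h * (⁅y, x⁆ ^ h * ⁅x, y⁆ ^ h) := by rw [hinv, mul_one]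
      _ = x * y * ⁅y, x⁆ ^ (2 * h) * ⁅x, y⁆ ^ h := by rw [two_mul, pow_add]; group
      _ = y * x * ⁅x, y⁆ ^ h := by rw [hpow, e]

theorem baer_nsmul_eq_pow (h : ℕ) (hc : ∀ x y : G, ⁅x, y⁆ ∈ Subgroup.center G)
    (hpow : ∀ x y : G, ⁅x, y⁆ ^ (2 * h) = ⁅x, y⁆) (n : ℕ) (x : G) :
    letI := baerAddCommGroup h hc hpow
    n • x = x ^ n := by
  let := baerAddCommGroup h hc hpow
  induction n with
  | zero => rw [zero_nsmul, pow_zero]; rfl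
  | succ n ih =>
    rw [succ_nsmul, ih, pow_succ]
    change x ^ n * x * ⁅x, x ^ n⁆ ^ h = _
    rw [commutatorElement_eq_one_iff_mul_comm.2 (pow_mul_comm' x n).symm, one_pow, mul_one]

/-- An automorphism, as an endomorphism of the Baer sum. -/
def baerEnd (h : ℕ) (hc : ∀ x y : G, ⁅x, y⁆ ∈ Subgroup.center G)
    (hpow : ∀ x y : G, ⁅x, y⁆ ^ (2 * h) = ⁅x, y⁆) (α : MulAut G) :
    letI := baerAddCommGroup h hc hpow
    AddMonoid.End G :=
  letI := baerAddCommGroup h hc hpow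
  { toFun := α
    map_zero' := map_one α
    map_add' := fun x y => by
      change α (x * y * ⁅y, x⁆ ^ h) = α x * α y * ⁅α y, α x⁆ ^ h
      rw [map_mul, map_mul, map_pow, map_commutatorElement] }

theorem baerEnd_pow_apply (h : ℕ) (hc : ∀ x y : G, ⁅x, y⁆ ∈ Subgroup.center G)
    (hpow : ∀ x y : G, ⁅x, y⁆ ^ (2 * h) = ⁅x, y⁆) (α : MulAut G) (n : ℕ) (x : G) :
    letI := baerAddCommGroup h hc hpow
    (baerEnd h hc hpow α ^ n) x = (α ^ n) x := by
  let := baerAddCommGroup h hc hpow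
  induction n generalizing x with
  | zero => rfl
  | succ n ih =>
    rw [pow_succ, pow_succ]
    exact ih (α x)

end CentralCommutators

/-- A nilpotent endomorphism of an abelian group of order `p ^ n` has `n`-th power zero. -/
theorem AddMonoid.End.pow_eq_zero_of_isNilpotent {A : Type*} [AddCommGroup A] [Finite A]
    {p n : ℕ} (hp : p.Prime) (hcard : Nat.card A = p ^ n) {N : AddMonoid.End A}
    (hN : IsNilpotent N) : N ^ n = 0 := by
  let R : ℕ → AddSubgroup A := fun k => AddMonoidHom.range (N ^ k : AddMonoid.End A)
  have eq_zero_of_range : ∀ k, R k = ⊥ → N ^ k = 0 := fun k hk =>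
    AddMonoidHom.range_eq_bot_iff.1 hk
  have range_succ : ∀ k, R (k + 1) = (R k).map N := by
    intro k
    ext y
    constructor
    · rintro ⟨x, rfl⟩
      exact ⟨(N ^ k) x, ⟨x, rfl⟩, by rw [pow_succ']; rfl⟩
    · rintro ⟨_, ⟨x, rfl⟩, rfl⟩
      exact ⟨x, by rw [pow_succ']; rfl⟩
  have range_le : ∀ k, R (k + 1) ≤ R k := by
    rintro k _ ⟨x, rfl⟩
    exact ⟨N x, by rw [pow_succ]; rfl⟩
  have key : ∀ k, N ^ k = 0 ∨ p ^ k * Nat.card (R k) ∣ p ^ n := by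
    intro k
    induction k with
    | zero =>
      right
      rw [pow_zero, one_mul, ← hcard]
      exact AddSubgroup.card_addSubgroup_dvd_card _
    | succ k ih =>
      rcases ih with h0 | hd
      · left; rw [pow_succ, h0, zero_mul]
      by_cases heq : R (k + 1) = R k
      · left
        obtain ⟨m, hm⟩ := hN
        have stable : ∀ j, R (k + j) = R k := by
          intro j
          induction j with
          | zero => rfl
          | succ j ih => rw [← add_assoc, range_succ, ih, ← range_succ, heq]
        have hz : N ^ (k + m) = 0 := by rw [pow_add, hm, mul_zero]
        have hb : R k = ⊥ := by
          rw [← stable m]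
          exact AddMonoidHom.range_eq_bot_iff.2 hz
        rw [pow_succ, eq_zero_of_range k hb, zero_mul]
      · right
        refine dvd_trans ?_ hd
        have hdvd : Nat.card (R (k + 1)) ∣ Nat.card (R k) :=
          AddSubgroup.card_dvd_of_le (range_le k)
        obtain ⟨a, -, ha⟩ := (Nat.dvd_prime_pow hp).1 (dvd_of_mul_left_dvd hd)
        obtain ⟨b, hb, hb'⟩ := (Nat.dvd_prime_pow hp).1 (ha ▸ hdvd)
        have hne : b ≠ a := by
          rintro rfl
          exact heq (AddSubgroup.eq_of_le_of_card_ge (range_le k) (by rw [ha, hb']))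
        rw [ha, hb', pow_succ, mul_assoc, ← pow_succ']
        exact mul_dvd_mul_left _ (pow_dvd_pow _ (by omega))
  rcases key n with h | h
  · exact h
  · have h1 : Nat.card (R n) ∣ 1 :=
      Nat.dvd_of_mul_dvd_mul_left (pow_pos hp.pos n) (by rwa [mul_one])
    exact eq_zero_of_range n (AddSubgroup.eq_bot_of_card_eq _ (Nat.dvd_one.1 h1))

theorem one_add_pow_prime_of_nsmul_eq_zero {R : Type*} [Ring R] {p : ℕ} (hp : p.Prime) {N : R}
    (hN : (p : R) * N = 0) : (1 + N) ^ p = 1 + N ^ p := by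
  obtain ⟨r, hr⟩ := (Commute.one_left N).exists_add_pow_prime_eq hp
  rw [hr, one_pow, mul_one, hN, zero_mul, add_zero]

/-- An automorphism of `p`-power order fixes every element of a characteristic subgroup of
order `p`. -/
theorem MulAut.apply_eq_self_of_mem_of_card_eq_prime {G : Type*} [Group G] {p k : ℕ}
    (hp : p.Prime) {Z : Subgroup G} [Z.Characteristic] (hZ : Nat.card Z = p) {α : MulAut G}
    (hα : α ^ p ^ k = 1) {z : G} (hz : z ∈ Z) : α z = z := by
  have := Fact.mk hp
  by_cases h1 : z = 1
  · rw [h1, map_one]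
  have hαz : α z ∈ Z := by
    have := Subgroup.characteristic_iff_map_eq.1 ‹Z.Characteristic› α
    rw [← this]
    exact ⟨z, hz, rfl⟩
  have hmem : (⟨α z, hαz⟩ : Z) ∈ Subgroup.zpowers (⟨z, hz⟩ : Z) :=
    mem_zpowers_of_prime_card hZ (fun h => h1 (congrArg Subtype.val h))
  obtain ⟨m, hm⟩ := Subgroup.mem_zpowers_iff.1 hmem
  have hm : z ^ m = α z := congrArg Subtype.val hm
  have iter : ∀ n : ℕ, (α ^ n) z = z ^ (m ^ n) := by
    intro n
    induction n with
    | zero => simp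
    | succ n ih => rw [pow_succ, MulAut.mul_apply, ← hm, map_zpow, ih, ← zpow_mul, pow_succ]
  have hzp : z ^ (p : ℤ) = 1 := by
    rw [zpow_natCast, ← hZ]
    exact congrArg Subtype.val (pow_card_eq_one' (x := (⟨z, hz⟩ : Z)))
  have hdvd : (p : ℤ) ∣ m ^ p ^ k - m := by
    rw [← ZMod.intCast_zmod_eq_zero_iff_dvd]
    push_cast
    rw [ZMod.pow_card_pow, sub_self]
  obtain ⟨c, hc⟩ := hdvd
  have h2 : z ^ (m ^ p ^ k) = z ^ m := by
    rw [eq_add_of_sub_eq hc, zpow_add, zpow_mul, hzp, one_zpow, one_mul]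
  rw [← hm, ← h2, ← iter, hα, MulAut.one_apply]

theorem extraspecial_p5_no_automorphism_of_order_p_sq (p : ℕ) (hp : p.Prime)
    (hp5 : 5 ≤ p) (G : Type*) [Group G] [Finite G]
    (hG : IsExtraspecial p G) (hcard : Nat.card G = p ^ 5) :
    ¬ ∃ α : MulAut G, orderOf α = p ^ 2 := by
  rintro ⟨α, hα⟩
  obtain ⟨-, hcomm, -, hZ⟩ := hG
  have hα2 : α ^ p ^ 2 = 1 := hα ▸ pow_orderOf_eq_one α
  have hc : ∀ x y : G, ⁅x, y⁆ ∈ Subgroup.center G := fun x y => by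
    rw [hcomm]
    exact Subgroup.commutator_mem_commutator (Subgroup.mem_top x) (Subgroup.mem_top y)
  have hcp : ∀ x y : G, ⁅x, y⁆ ^ p = 1 := fun x y => by
    rw [← hZ]
    exact congrArg Subtype.val (pow_card_eq_one' (x := (⟨⁅x, y⁆, hc x y⟩ : Subgroup.center G)))
  obtain ⟨k, hk⟩ := hp.odd_of_ne_two (by omega)
  have hpow : ∀ x y : G, ⁅x, y⁆ ^ (2 * (k + 1)) = ⁅x, y⁆ := fun x y => by
    rw [show 2 * (k + 1) = p + 1 by omega, pow_succ, hcp, one_mul]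
  let := baerAddCommGroup (k + 1) hc hpow
  set A := baerEnd (k + 1) hc hpow α
  have hApow : ∀ (n : ℕ) (x : G), (A ^ n) x = (α ^ n) x := baerEnd_pow_apply (k + 1) hc hpow α
  obtain ⟨N, hN⟩ : ∃ N, A = 1 + N := ⟨A - 1, by abel⟩
  have hpN : (p : AddMonoid.End G) * N = 0 := by
    rw [Nat.cast_comm]
    ext x
    have hfix : A (p • x) = p • x := by
      rw [baer_nsmul_eq_pow (k + 1) hc hpow]
      exact MulAut.apply_eq_self_of_mem_of_card_eq_prime hp hZ hα2
        (pow_mem_center_of_commutatorElement_pow_eq_one hc hcp x)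
    rw [hN] at hfix
    exact left_eq_add.1 hfix.symm
  have hpow1 : A ^ p = 1 + N ^ p := by rw [hN, one_add_pow_prime_of_nsmul_eq_zero hp hpN]
  have hnil : IsNilpotent N := by
    refine ⟨p * p, ?_⟩
    have hpNp : (p : AddMonoid.End G) * N ^ p = 0 := by
      rw [← Nat.sub_add_cancel hp.one_le, pow_succ', Nat.sub_add_cancel hp.one_le, ← mul_assoc,
        hpN, zero_mul]
    have h1 : A ^ (p * p) = 1 := by
      ext x
      rw [hApow, ← sq, hα2]
      rfl
    rw [pow_mul, hpow1, one_add_pow_prime_of_nsmul_eq_zero hp hpNp, ← pow_mul] at h1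
    exact add_eq_left.1 h1
  have hN5 : N ^ p = 0 :=
    pow_eq_zero_of_le hp5 (AddMonoid.End.pow_eq_zero_of_isNilpotent hp hcard hnil)
  have hαp : α ^ p = 1 := by
    ext x
    rw [← hApow, hpow1, hN5, add_zero]
    rfl
  have hdvd : p ^ 2 ∣ p ^ 1 := by
    rw [← hα, pow_one]
    exact orderOf_dvd_of_pow_eq_one hαp
  exact absurd ((Nat.pow_dvd_pow_iff_le_right hp.one_lt).1 hdvd) (by norm_num)
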